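/- Let X be a separable reflexive Banach space and let Y ⊆ X be the closed linear span of a directed (under inclusion) family (Y_i)_{i∈I} of closed subspaces. Then the isometric envelope of Y equals the closure of the union of the isometric envelopes of the Y_i: Env(Y) = closure(⋃_i Env(Y_i)). -/

import Mathlib

open Filter

/-- `x` belongs to the isometric envelope of the set `Y` in `X`: every net of surjective
linear isometries of `X` converging pointwise on `Y` to the identity converges at `x`
to `x` (nets are rendered by filters on the isometry group). -/
def MemEnv {X : Type*} [NormedAddCommGroup X] [NormedSpace ℝ X]
    (Y : Set X) (x : X) : Prop :=
  ∀ F : Filter (X ≃ₗᵢ[ℝ] X), F.NeBot →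
    (∀ y ∈ Y, Tendsto (fun T : X ≃ₗᵢ[ℝ] X => T y) F (nhds y)) →
    Tendsto (fun T : X ≃ₗᵢ[ℝ] X => T x) F (nhds x)

open Set Topology

section WeakCompactness

variable {X : Type*} [NormedAddCommGroup X] [NormedSpace ℝ X]

/-- A subset of a normed space is weakly closed if it is closed in the weak topology. -/
def IsWeaklyClosed (s : Set X) : Prop :=
  IsClosed ((toWeakSpace ℝ X).symm ⁻¹' s)

lemma IsWeaklyClosed.inter {s t : Set X} (hs : IsWeaklyClosed s) (ht : IsWeaklyClosed t) :
    IsWeaklyClosed (s ∩ t) :=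
  IsClosed.inter hs ht

lemma IsWeaklyClosed.sInter {S : Set (Set X)} (hS : ∀ s ∈ S, IsWeaklyClosed s) :
    IsWeaklyClosed (⋂₀ S) := by
  unfold IsWeaklyClosed
  rw [preimage_sInter]
  exact isClosed_biInter hS

/-- Mazur's theorem. -/
lemma Convex.isWeaklyClosed {s : Set X} (hs : Convex ℝ s) (hc : IsClosed s) :
    IsWeaklyClosed s := by
  have h := hs.toWeakSpace_closure ℝ
  rw [hc.closure_eq] at h
  unfold IsWeaklyClosed
  rw [← LinearEquiv.image_eq_preimage_symm, h]
  exact isClosed_closure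

lemma isClosed_strongDual_le (f : StrongDual ℝ X) (c : ℝ) : IsClosed {z | f z ≤ c} :=
  isClosed_le f.continuous continuous_const

lemma convex_strongDual_le (f : StrongDual ℝ X) (c : ℝ) : Convex ℝ {z | f z ≤ c} :=
  convex_halfSpace_le f.toLinearMap.isLinear c

lemma isWeaklyClosed_setOf_ge (f : StrongDual ℝ X) (c : ℝ) : IsWeaklyClosed {z | c ≤ f z} :=
  (convex_halfSpace_ge f.toLinearMap.isLinear c).isWeaklyClosed
    (isClosed_le continuous_const f.continuous)

/-- In a reflexive space, bounded weakly closed sets are weakly compact. -/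
lemma IsWeaklyClosed.isCompact
    (hrefl : Function.Surjective (NormedSpace.inclusionInDoubleDual ℝ X))
    {s : Set X} (hs : IsWeaklyClosed s) (hb : Bornology.IsBounded s) :
    IsCompact ((toWeakSpace ℝ X).symm ⁻¹' s) := by
  have hcl : IsClosed ((toWeakSpace ℝ X).symm ⁻¹' s) := hs
  rw [← hcl.closure_eq]
  refine NormedSpace.isCompact_closure_of_isBounded ℝ X _ ?_ ?_
  · rw [← preimage_comp]
    simpa [Function.comp_def] using hb
  · intro φ _
    obtain ⟨x, hx⟩ := hrefl (WeakDual.toStrongDual φ)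
    refine ⟨toWeakSpace ℝ X x, ?_⟩
    refine ContinuousLinearMap.ext fun f => ?_
    exact congrArg (fun g => g f) hx

/-- Cantor's intersection theorem for the weak topology of a reflexive space. -/
lemma nonempty_sInter_of_isWeaklyClosed
    (hrefl : Function.Surjective (NormedSpace.inclusionInDoubleDual ℝ X))
    {S : Set (Set X)} (hne : S.Nonempty) (hdir : DirectedOn (· ⊇ ·) S)
    (hn : ∀ s ∈ S, s.Nonempty) (hc : ∀ s ∈ S, IsWeaklyClosed s)
    (hb : ∀ s ∈ S, Bornology.IsBounded s) : (⋂₀ S).Nonempty := by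
  have : Nonempty S := hne.to_subtype
  obtain ⟨z, hz⟩ := IsCompact.nonempty_iInter_of_directed_nonempty_isCompact_isClosed
    (fun s : S => (toWeakSpace ℝ X).symm ⁻¹' s.1)
    (fun a b => by
      obtain ⟨d, hd, ha, hb⟩ := hdir a.1 a.2 b.1 b.2
      exact ⟨⟨d, hd⟩, preimage_mono ha, preimage_mono hb⟩)
    (fun s => (hn s.1 s.2).preimage (toWeakSpace ℝ X).symm.surjective)
    (fun s => (hc s.1 s.2).isCompact hrefl (hb s.1 s.2)) (fun s => hc s.1 s.2)
  refine ⟨(toWeakSpace ℝ X).symm z, fun s hs => ?_⟩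
  exact mem_iInter.1 hz ⟨s, hs⟩

/-- A chain of bounded weakly closed sets each meeting the weakly closed set `K` has an
intersection meeting `K`. -/
lemma IsChain.nonempty_sInter_inter_of_isWeaklyClosed
    (hrefl : Function.Surjective (NormedSpace.inclusionInDoubleDual ℝ X))
    {S : Set (Set X)} (hS : IsChain (· ⊆ ·) S) (hne : S.Nonempty)
    {K : Set X} (hK : IsWeaklyClosed K) (hn : ∀ s ∈ S, (s ∩ K).Nonempty)
    (hc : ∀ s ∈ S, IsWeaklyClosed s) (hb : ∀ s ∈ S, Bornology.IsBounded s) :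
    (⋂₀ S ∩ K).Nonempty := by
  obtain ⟨z, hz⟩ := nonempty_sInter_of_isWeaklyClosed hrefl (S := (fun s => s ∩ K) '' S)
    (hne.image _)
    (by
      rintro _ ⟨s, hs, rfl⟩ _ ⟨t, ht, rfl⟩
      rcases hS.total hs ht with h | h
      · exact ⟨_, ⟨s, hs, rfl⟩, subset_rfl, inter_subset_inter_left _ h⟩
      · exact ⟨_, ⟨t, ht, rfl⟩, inter_subset_inter_left _ h, subset_rfl⟩)
    (by rintro _ ⟨s, hs, rfl⟩; exact hn s hs)
    (by rintro _ ⟨s, hs, rfl⟩; exact (hc s hs).inter hK)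
    (by rintro _ ⟨s, hs, rfl⟩; exact (hb s hs).subset inter_subset_left)
  obtain ⟨s, hs⟩ := hne
  exact ⟨z, fun t ht => (hz _ ⟨t, ht, rfl⟩).1, (hz _ ⟨s, hs, rfl⟩).2⟩

lemma exists_lt_of_mem_closedConvexHull {s : Set X} {z : X} (hz : z ∈ closedConvexHull ℝ s)
    (f : StrongDual ℝ X) {c : ℝ} (hc : c < f z) : ∃ y ∈ s, c < f y := by
  by_contra! h
  exact hc.not_ge (closedConvexHull_min (t := {z | f z ≤ c}) h (convex_strongDual_le f c)
    (isClosed_strongDual_le f c) hz)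

end WeakCompactness

section Dentability

variable {X : Type*} [NormedAddCommGroup X] [NormedSpace ℝ X]

/-- A bounded closed convex subset of a reflexive space contains a minimal weakly closed set among
those whose closed convex hull contains it. -/
lemma exists_minimal_isWeaklyClosed_closedConvexHull
    (hrefl : Function.Surjective (NormedSpace.inclusionInDoubleDual ℝ X))
    {C : Set X} (hcl : IsClosed C) (hconv : Convex ℝ C) (hb : Bornology.IsBounded C) :
    ∃ E, Minimal
      (· ∈ {E : Set X | E ⊆ C ∧ IsWeaklyClosed E ∧ C ⊆ closedConvexHull ℝ E}) E := by
  suffices h : ∀ c ⊆ {E : Set X | E ⊆ C ∧ IsWeaklyClosed E ∧ C ⊆ closedConvexHull ℝ E},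
      IsChain (· ⊆ ·) c → c.Nonempty →
      ∃ lb ∈ {E : Set X | E ⊆ C ∧ IsWeaklyClosed E ∧ C ⊆ closedConvexHull ℝ E},
        ∀ s ∈ c, lb ⊆ s by
    obtain ⟨E, -, hE⟩ := zorn_superset_nonempty _ h C
      ⟨subset_rfl, hconv.isWeaklyClosed hcl, subset_closedConvexHull⟩
    exact ⟨E, hE⟩
  intro c hc hchain hne
  refine ⟨⋂₀ c, ⟨?_, IsWeaklyClosed.sInter fun s hs => (hc hs).2.1, fun z hz => ?_⟩,
    fun s hs => sInter_subset_of_mem hs⟩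
  · obtain ⟨s, hs⟩ := hne
    exact (sInter_subset_of_mem hs).trans (hc hs).1
  by_contra hz'
  obtain ⟨f, u, hf, hu⟩ := geometric_hahn_banach_closed_point convex_closedConvexHull
    isClosed_closedConvexHull hz'
  obtain ⟨w, hw, huw⟩ := hchain.nonempty_sInter_inter_of_isWeaklyClosed hrefl hne
    (isWeaklyClosed_setOf_ge f u)
    (fun s hs => by
      obtain ⟨y, hy, hy'⟩ := exists_lt_of_mem_closedConvexHull ((hc hs).2.2 hz) f hu
      exact ⟨y, hy, hy'.le⟩)
    (fun s hs => (hc hs).2.1) (fun s hs => hb.subset (hc hs).1)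
  exact (hf w (subset_closedConvexHull hw)).not_ge huw

/-- A nonempty weakly closed bounded subset of a separable reflexive space has a nonempty relatively
weakly open subset of small diameter; equivalently, a proper weakly closed subset whose
complement is contained in a small ball. -/
lemma IsWeaklyClosed.exists_ssubset_diff_subset_closedBall
    [TopologicalSpace.SeparableSpace X]
    (hrefl : Function.Surjective (NormedSpace.inclusionInDoubleDual ℝ X))
    {E : Set X} (hE : IsWeaklyClosed E) (hb : Bornology.IsBounded E) (hne : E.Nonempty)
    {ε : ℝ} (hε : 0 < ε) :
    ∃ E' ⊂ E, IsWeaklyClosed E' ∧ ∃ x, E \ E' ⊆ Metric.closedBall x ε := by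
  let w := (toWeakSpace ℝ X).symm
  have : T2Space (WeakSpace ℝ X) :=
    (NormedSpace.isEmbedding_inclusionInDoubleDualWeak ℝ X).t2Space
  have : CompactSpace (w ⁻¹' E) := isCompact_iff_compactSpace.1 (hE.isCompact hrefl hb)
  have : Nonempty (w ⁻¹' E) := (hne.preimage w.surjective).to_subtype
  obtain ⟨n, e, he⟩ := nonempty_interior_of_iUnion_of_closed
    (f := fun n : ℕ => {e : w ⁻¹' E | w e ∈ Metric.closedBall (TopologicalSpace.denseSeq X n) ε})
    (fun n => IsClosed.preimage continuous_subtype_val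
      ((convex_closedBall _ _).isWeaklyClosed Metric.isClosed_closedBall))
    (by
      refine eq_univ_of_forall fun e => mem_iUnion.2 ?_
      obtain ⟨n, hn⟩ := (TopologicalSpace.denseRange_denseSeq X).exists_dist_lt (w e) hε
      exact ⟨n, hn.le⟩)
  obtain ⟨W, hW, hWe⟩ := isOpen_induced_iff.1 (isOpen_interior
    (s := {e : w ⁻¹' E | w e ∈ Metric.closedBall (TopologicalSpace.denseSeq X n) ε}))
  have key : ∀ v (hv : w v ∈ E), v ∈ W ↔ (⟨v, hv⟩ : w ⁻¹' E) ∈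
      interior {e : w ⁻¹' E | w e ∈ Metric.closedBall (TopologicalSpace.denseSeq X n) ε} := by
    intro v hv
    rw [← hWe]
    rfl
  refine ⟨E \ w.symm ⁻¹' W, ⟨sdiff_subset, fun h => ?_⟩, ?_, TopologicalSpace.denseSeq X n, ?_⟩
  · exact (h e.2).2 ((key e.1 e.2).2 he)
  · have : w ⁻¹' (E \ w.symm ⁻¹' W) = w ⁻¹' E ∩ Wᶜ := by
      ext v
      simp
    unfold IsWeaklyClosed
    change IsClosed (w ⁻¹' (E \ w.symm ⁻¹' W))
    rw [this]
    exact IsClosed.inter hE hW.isClosed_compl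
  · rintro z ⟨hz, hz'⟩
    have hzW : w.symm z ∈ W := by
      by_contra h
      exact hz' ⟨hz, h⟩
    have := interior_subset ((key (w.symm z) (by simpa using hz)).1 hzW)
    simpa using this

/-- Nonempty bounded closed convex subsets of a separable reflexive space are dentable. -/
lemma exists_slice_dist_le [TopologicalSpace.SeparableSpace X]
    (hrefl : Function.Surjective (NormedSpace.inclusionInDoubleDual ℝ X))
    {C : Set X} (hcl : IsClosed C) (hconv : Convex ℝ C) (hb : Bornology.IsBounded C)
    (hne : C.Nonempty) {ε : ℝ} (hε : 0 < ε) :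
    ∃ (f : StrongDual ℝ X) (c : ℝ), (∃ z ∈ C, c < f z) ∧
      ∀ z ∈ C, ∀ w ∈ C, c < f z → c < f w → dist z w ≤ ε := by
  obtain ⟨E, ⟨hEC, hEw, hEh⟩, hmin⟩ :=
    exists_minimal_isWeaklyClosed_closedConvexHull hrefl hcl hconv hb
  have hEne : E.Nonempty := by
    obtain ⟨z, hz⟩ := hne
    obtain ⟨y, hy, -⟩ := exists_lt_of_mem_closedConvexHull (hEh hz) 0 (c := -1) (by simp)
    exact ⟨y, hy⟩
  obtain ⟨E', hE', hE'w, x₀, hx₀⟩ :=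
    hEw.exists_ssubset_diff_subset_closedBall hrefl (hb.subset hEC) hEne
      (show 0 < ε / 4 by positivity)
  have hnot : ¬ C ⊆ closedConvexHull ℝ E' := fun h =>
    hE'.2 (hmin ⟨hE'.1.trans hEC, hE'w, h⟩ hE'.1)
  obtain ⟨y, hyC, hy⟩ := not_subset.1 hnot
  obtain ⟨f, a, hfa, hay⟩ := geometric_hahn_banach_closed_point convex_closedConvexHull
    isClosed_closedConvexHull hy
  obtain ⟨M, hM0, hM⟩ : ∃ M, 0 ≤ M ∧ ∀ z ∈ C, dist z x₀ ≤ M := by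
    obtain ⟨M, hM⟩ := hb.subset_closedBall x₀
    exact ⟨M, dist_nonneg.trans (hM hyC), hM⟩
  have hbdd : BddAbove (f '' C) := (f.lipschitz.isBounded_image hb).bddAbove
  set s := sSup (f '' C) with hs
  have hfs : ∀ z ∈ C, f z ≤ s := fun z hz => le_csSup hbdd ⟨z, hz, rfl⟩
  have has : 0 < s - a := by linarith [hfs y hyC]
  set κ := M / (s - a) with hκ
  have hκ0 : 0 ≤ κ := div_nonneg hM0 has.le
  have hsub : C ⊆ {z | dist z x₀ + κ * f z ≤ ε / 4 + κ * s} := by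
    refine hEh.trans (closedConvexHull_min (fun e he => ?_) ?_ ?_)
    · by_cases h : e ∈ E'
      · have h1 : f e ≤ a := (hfa e (subset_closedConvexHull h)).le
        have h2 : M = κ * (s - a) := by rw [hκ]; field_simp
        have h3 := mul_le_mul_of_nonneg_left h1 hκ0
        have h4 := hM e (hEC he)
        simp only [mem_ofPred_eq]
        nlinarith
      · have h1 : dist e x₀ ≤ ε / 4 := hx₀ ⟨he, h⟩
        have h3 := mul_le_mul_of_nonneg_left (hfs e (hEC he)) hκ0
        simp only [mem_ofPred_eq]
        linarith
    · have h1 : ConvexOn ℝ univ (fun z : X => dist z x₀) := convexOn_univ_dist x₀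
      have h2 : ConvexOn ℝ univ (fun z : X => κ * f z) :=
        (κ • f).toLinearMap.convexOn convex_univ
      simpa using (h1.add h2).convex_le (ε / 4 + κ * s)
    · exact isClosed_le (by fun_prop) (by fun_prop)
  have hδ : 0 < ε / (4 * (κ + 1)) := by positivity
  refine ⟨f, s - ε / (4 * (κ + 1)), ?_, fun z hz w hw hfz hfw => ?_⟩
  · obtain ⟨_, ⟨z, hz, rfl⟩, h⟩ := exists_lt_of_lt_csSup (hne.image f)
      (show s - ε / (4 * (κ + 1)) < sSup (f '' C) by rw [← hs]; linarith)
    exact ⟨z, hz, h⟩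
  · have hκδ : κ * (ε / (4 * (κ + 1))) ≤ ε / 4 := by
      rw [mul_div_assoc', div_le_div_iff₀ (by positivity) (by positivity)]
      nlinarith
    have near : ∀ z ∈ C, s - ε / (4 * (κ + 1)) < f z → dist z x₀ ≤ ε / 2 := by
      intro z hz hfz
      have h1 : dist z x₀ + κ * f z ≤ ε / 4 + κ * s := hsub hz
      have h2 := mul_le_mul_of_nonneg_left hfz.le hκ0
      linarith
    linarith [dist_triangle_right z w x₀, near z hz hfz, near w hw hfw]

end Dentability

section FixedPoint

variable {X : Type*} [NormedAddCommGroup X] [NormedSpace ℝ X]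

lemma LinearIsometryEquiv.apply_mem_closedConvexHull (T : X ≃ₗᵢ[ℝ] X) {s t : Set X}
    (h : ∀ z ∈ s, T z ∈ closedConvexHull ℝ t) {z : X} (hz : z ∈ closedConvexHull ℝ s) :
    T z ∈ closedConvexHull ℝ t :=
  closedConvexHull_min (t := T ⁻¹' closedConvexHull ℝ t) h
    (convex_closedConvexHull.linear_preimage T.toLinearEquiv.toLinearMap)
    (isClosed_closedConvexHull.preimage T.continuous) hz

/-- Among the bounded closed convex sets invariant under all isometries and meeting a weakly closed
set `K`, there is a minimal one. -/
lemma exists_minimal_invariant_inter_nonempty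
    (hrefl : Function.Surjective (NormedSpace.inclusionInDoubleDual ℝ X))
    {K : Set X} (hK : IsWeaklyClosed K) (hne : K.Nonempty) :
    ∃ C, Bornology.IsBounded C ∧ Minimal (· ∈ {C : Set X | IsClosed C ∧ Convex ℝ C ∧
      (∀ T : X ≃ₗᵢ[ℝ] X, ∀ z ∈ C, T z ∈ C) ∧ (C ∩ K).Nonempty}) C := by
  obtain ⟨x, hx⟩ := hne
  let S : Set (Set X) := {C | C ⊆ Metric.closedBall 0 ‖x‖ ∧ IsClosed C ∧ Convex ℝ C ∧
    (∀ T : X ≃ₗᵢ[ℝ] X, ∀ z ∈ C, T z ∈ C) ∧ (C ∩ K).Nonempty}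
  suffices h : ∀ c ⊆ S, IsChain (· ⊆ ·) c → c.Nonempty → ∃ lb ∈ S, ∀ s ∈ c, lb ⊆ s by
    obtain ⟨C, -, ⟨hC, hCS⟩, hmin⟩ := zorn_superset_nonempty S h (Metric.closedBall 0 ‖x‖)
      ⟨subset_rfl, Metric.isClosed_closedBall, convex_closedBall _ _,
        fun T z hz => by simpa using hz, x, by simp, hx⟩
    exact ⟨C, Metric.isBounded_closedBall.subset hC, hCS,
      fun D hD hDC => hmin ⟨hDC.trans hC, hD⟩ hDC⟩
  intro c hc hchain hne
  refine ⟨⋂₀ c, ⟨?_, isClosed_sInter fun s hs => (hc hs).2.1,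
    convex_sInter fun s hs => (hc hs).2.2.1,
    fun T z hz s hs => (hc hs).2.2.2.1 T z (hz s hs), ?_⟩, fun s hs => sInter_subset_of_mem hs⟩
  · obtain ⟨s, hs⟩ := hne
    exact (sInter_subset_of_mem hs).trans (hc hs).1
  · exact hchain.nonempty_sInter_inter_of_isWeaklyClosed hrefl hne hK
      (fun s hs => (hc hs).2.2.2.2) (fun s hs => (hc hs).2.2.1.isWeaklyClosed (hc hs).2.1)
      (fun s hs => Metric.isBounded_closedBall.subset (hc hs).1)

/-- In a separable reflexive space, every nonempty closed convex set `K` meets some bounded closed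
convex set `C`, invariant under all isometries, in exactly one point, and this point is a
denting point of `C`. This replaces an isometry-invariant locally uniformly rotund renorming. -/
lemma exists_invariant_inter_eq_singleton [TopologicalSpace.SeparableSpace X]
    (hrefl : Function.Surjective (NormedSpace.inclusionInDoubleDual ℝ X))
    {K : Set X} (hKcl : IsClosed K) (hKconv : Convex ℝ K) (hne : K.Nonempty) :
    ∃ (C : Set X) (p : X), Bornology.IsBounded C ∧ IsClosed C ∧ Convex ℝ C ∧
      (∀ T : X ≃ₗᵢ[ℝ] X, ∀ z ∈ C, T z ∈ C) ∧ C ∩ K = {p} ∧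
      ∀ ε > 0, ∃ (f : StrongDual ℝ X) (c : ℝ), c < f p ∧
        ∀ z ∈ C, ∀ w ∈ C, c < f z → c < f w → dist z w ≤ ε := by
  obtain ⟨C, hCb, ⟨hCcl, hCconv, hCinv, p, hpC, hpK⟩, hmin⟩ :=
    exists_minimal_invariant_inter_nonempty hrefl (hKconv.isWeaklyClosed hKcl) hne
  refine ⟨C, p, hCb, hCcl, hCconv, hCinv, ?_, fun ε hε => ?_⟩
  · refine Subset.antisymm (fun q hq => ?_) (by simp [hpC, hpK])
    refine dist_le_zero.1 (le_of_forall_pos_le_add fun ε hε => ?_)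
    have hmC := hCconv.midpoint_mem hq.1 hpC
    have hmK := hKconv.midpoint_mem hq.2 hpK
    have hhull : C ⊆ closedConvexHull ℝ (range fun T : X ≃ₗᵢ[ℝ] X => T (midpoint ℝ q p)) := by
      refine hmin ⟨isClosed_closedConvexHull, convex_closedConvexHull, fun T z hz => ?_,
        midpoint ℝ q p, subset_closedConvexHull ⟨1, rfl⟩, hmK⟩
        (closedConvexHull_min ?_ hCconv hCcl)
      · refine T.apply_mem_closedConvexHull ?_ hz
        rintro _ ⟨R, rfl⟩
        exact subset_closedConvexHull ⟨T * R, rfl⟩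
      · rintro _ ⟨R, rfl⟩
        exact hCinv R _ hmC
    obtain ⟨f, c, ⟨z, hz, hcz⟩, hf⟩ := exists_slice_dist_le hrefl hCcl hCconv hCb ⟨p, hpC⟩
      (show 0 < ε / 2 by positivity)
    obtain ⟨_, ⟨T, rfl⟩, hT⟩ := exists_lt_of_mem_closedConvexHull (hhull hz) f hcz
    have hmid : T (midpoint ℝ q p) = midpoint ℝ (T q) (T p) :=
      T.toLinearIsometry.toLinearMap.toAffineMap.map_midpoint q p
    have hTm := hCinv T _ hmC
    have hTq := hCinv T q hq.1
    have hTp := hCinv T p hpC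
    have hfm : f (T (midpoint ℝ q p)) = (f (T q) + f (T p)) / 2 := by
      rw [hmid, midpoint_eq_smul_add]
      simp
      ring
    have hdist : dist q p = dist (T q) (T p) := (T.dist_map q p).symm
    have hc : c < f (T q) ∨ c < f (T p) := by
      by_contra! h
      have : c < f (T (midpoint ℝ q p)) := hT
      linarith [h.1, h.2]
    rcases hc with h | h
    · have := hf _ hTq _ hTm h hT
      rw [hmid, dist_left_midpoint] at this
      norm_num at this
      linarith
    · have := hf _ hTp _ hTm h hT
      rw [hmid, dist_right_midpoint] at this
      norm_num at this
      linarith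
  · by_contra! hcon
    let D : Set X := {z ∈ C | ∀ (f : StrongDual ℝ X) (c : ℝ),
      (∀ z ∈ C, ∀ w ∈ C, c < f z → c < f w → dist z w ≤ ε) → f z ≤ c}
    have hD : C ⊆ D := by
      refine hmin ⟨?_, ?_, fun T z hz => ⟨hCinv T z hz.1, fun f c hf => ?_⟩, p, ⟨hpC, ?_⟩, hpK⟩
        (fun z hz => hz.1)
      · simp only [D, ← inter_ofPred_eq_sep, ofPred_forall]
        exact hCcl.inter (isClosed_iInter fun f => isClosed_iInter fun c =>
          isClosed_iInter fun _ => isClosed_strongDual_le f c)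
      · simp only [D, ← inter_ofPred_eq_sep, ofPred_forall]
        exact hCconv.inter (convex_iInter fun f => convex_iInter fun c =>
          convex_iInter fun _ => convex_strongDual_le f c)
      · refine hz.2 (f.comp (T : X →L[ℝ] X)) c fun u hu v hv hfu hfv => ?_
        rw [← T.dist_map]
        exact hf _ (hCinv T u hu) _ (hCinv T v hv) hfu hfv
      · intro f c hf
        by_contra! h
        obtain ⟨z, hz, w, hw, hz', hw', hzw⟩ := hcon f c h
        exact hzw.not_ge (hf z hz w hw hz' hw')
    obtain ⟨f, c, ⟨z, hz, hcz⟩, hf⟩ := exists_slice_dist_le hrefl hCcl hCconv hCb ⟨p, hpC⟩ hε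
    exact hcz.not_ge ((hD hz).2 f c hf)

/-- If a filter of isometries is stable under composition, then the intersection of the
closed convex hulls of the tails of the orbit of `x` contains a point at which the filter
converges to the identity. -/
lemma exists_tendsto_apply_nhds_self [TopologicalSpace.SeparableSpace X]
    (hrefl : Function.Surjective (NormedSpace.inclusionInDoubleDual ℝ X))
    (F : Filter (X ≃ₗᵢ[ℝ] X)) [F.NeBot]
    (hmul : Tendsto (fun p : (X ≃ₗᵢ[ℝ] X) × (X ≃ₗᵢ[ℝ] X) => p.1 * p.2) (F ×ˢ F) F) (x : X) :
    ∃ p : X, (∀ U ∈ F, p ∈ closedConvexHull ℝ ((fun T : X ≃ₗᵢ[ℝ] X => T x) '' U)) ∧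
      Tendsto (fun T : X ≃ₗᵢ[ℝ] X => T p) F (𝓝 p) := by
  let H (U : Set (X ≃ₗᵢ[ℝ] X)) : Set X := closedConvexHull ℝ ((fun T : X ≃ₗᵢ[ℝ] X => T x) '' U)
  have hmono : ∀ {U V}, U ⊆ V → H U ⊆ H V := fun h =>
    (closedConvexHull ℝ).monotone (image_mono h)
  have hHw : ∀ U, IsWeaklyClosed (H U) := fun U =>
    convex_closedConvexHull.isWeaklyClosed isClosed_closedConvexHull
  have hHb : ∀ U, Bornology.IsBounded (H U) := fun U => by
    refine Metric.isBounded_closedBall (x := (0 : X)) (r := ‖x‖) |>.subset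
      (closedConvexHull_min ?_ (convex_closedBall _ _) Metric.isClosed_closedBall)
    rintro _ ⟨T, -, rfl⟩
    simp
  have hKne : (⋂₀ (H '' F.sets)).Nonempty := by
    refine nonempty_sInter_of_isWeaklyClosed hrefl ⟨_, univ, univ_mem, rfl⟩ ?_ ?_ ?_ ?_
    · rintro _ ⟨U, hU, rfl⟩ _ ⟨V, hV, rfl⟩
      exact ⟨_, ⟨U ∩ V, inter_mem hU hV, rfl⟩, hmono inter_subset_left, hmono inter_subset_right⟩
    · rintro _ ⟨U, hU, rfl⟩
      obtain ⟨T, hT⟩ := Filter.nonempty_of_mem hU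
      exact ⟨T x, subset_closedConvexHull ⟨T, hT, rfl⟩⟩
    · rintro _ ⟨U, -, rfl⟩
      exact hHw U
    · rintro _ ⟨U, -, rfl⟩
      exact hHb U
  obtain ⟨C, p, hCb, hCcl, hCconv, hCinv, hCK, hdent⟩ :=
    exists_invariant_inter_eq_singleton hrefl
      (isClosed_sInter (by rintro _ ⟨U, -, rfl⟩; exact isClosed_closedConvexHull))
      (convex_sInter (by rintro _ ⟨U, -, rfl⟩; exact convex_closedConvexHull)) hKne
  have hp : p ∈ C ∩ ⋂₀ (H '' F.sets) := hCK ▸ mem_singleton p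
  refine ⟨p, fun U hU => hp.2 _ ⟨U, hU, rfl⟩, Metric.tendsto_nhds.2 fun ε hε => ?_⟩
  obtain ⟨f, c, hcp, hf⟩ := hdent (ε / 2) (by positivity)
  obtain ⟨V, hV, hVc⟩ : ∃ V ∈ F, ∀ z ∈ C, z ∈ H V → c < f z := by
    by_contra! hcon
    have hw : IsWeaklyClosed (C ∩ {z | f z ≤ c}) :=
      (hCconv.inter (convex_strongDual_le f c)).isWeaklyClosed
        (hCcl.inter (isClosed_strongDual_le f c))
    obtain ⟨z, hz⟩ := nonempty_sInter_of_isWeaklyClosed hrefl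
      (S := (fun U => (C ∩ {z | f z ≤ c}) ∩ H U) '' F.sets) ⟨_, univ, univ_mem, rfl⟩
      (by
        rintro _ ⟨U, hU, rfl⟩ _ ⟨V, hV, rfl⟩
        exact ⟨_, ⟨U ∩ V, inter_mem hU hV, rfl⟩,
          inter_subset_inter_right _ (hmono inter_subset_left),
          inter_subset_inter_right _ (hmono inter_subset_right)⟩)
      (by
        rintro _ ⟨U, hU, rfl⟩
        obtain ⟨z, hzC, hzH, hzc⟩ := hcon U hU
        exact ⟨z, ⟨hzC, hzc⟩, hzH⟩)
      (by rintro _ ⟨U, -, rfl⟩; exact hw.inter (hHw U))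
      (by rintro _ ⟨U, -, rfl⟩; exact (hHb U).subset inter_subset_right)
    have hzC := (hz _ ⟨univ, univ_mem, rfl⟩).1
    have hzp : z ∈ C ∩ ⋂₀ (H '' F.sets) :=
      ⟨hzC.1, by rintro _ ⟨U, hU, rfl⟩; exact (hz _ ⟨U, hU, rfl⟩).2⟩
    rw [hCK, mem_singleton_iff] at hzp
    subst hzp
    exact hcp.not_ge hzC.2
  obtain ⟨U, hU, hUV⟩ := mem_prod_same_iff.1 (hmul hV)
  filter_upwards [hU] with T hT
  have hTV : T p ∈ H V := by
    refine T.apply_mem_closedConvexHull ?_ (hp.2 _ ⟨U, hU, rfl⟩)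
    rintro _ ⟨R, hR, rfl⟩
    exact subset_closedConvexHull ⟨T * R, hUV (mk_mem_prod hT hR), rfl⟩
  have hTC := hCinv T p hp.1
  linarith [hf _ hTC _ hp.1 (hVc _ hTC hTV) hcp]

end FixedPoint

section Envelope

variable {X : Type*} [NormedAddCommGroup X] [NormedSpace ℝ X]

/-- The coarsest filter on the isometry group converging to the identity pointwise on `Y`. -/
def pointwiseNhdsOne (Y : Set X) : Filter (X ≃ₗᵢ[ℝ] X) :=
  ⨅ y ∈ Y, comap (fun T : X ≃ₗᵢ[ℝ] X => T y) (𝓝 y)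

lemma le_pointwiseNhdsOne_iff {Y : Set X} {F : Filter (X ≃ₗᵢ[ℝ] X)} :
    F ≤ pointwiseNhdsOne Y ↔ ∀ y ∈ Y, Tendsto (fun T : X ≃ₗᵢ[ℝ] X => T y) F (𝓝 y) := by
  simp [pointwiseNhdsOne, tendsto_iff_comap]

lemma pure_one_le_pointwiseNhdsOne (Y : Set X) :
    pure (1 : X ≃ₗᵢ[ℝ] X) ≤ pointwiseNhdsOne Y :=
  le_pointwiseNhdsOne_iff.2 fun _ _ => tendsto_pure_left.2 fun _ hs => mem_of_mem_nhds hs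

instance pointwiseNhdsOne_neBot (Y : Set X) : (pointwiseNhdsOne Y).NeBot :=
  neBot_of_le (pure_one_le_pointwiseNhdsOne Y)

lemma pointwiseNhdsOne_anti {Y Z : Set X} (h : Y ⊆ Z) :
    pointwiseNhdsOne Z ≤ pointwiseNhdsOne Y :=
  le_pointwiseNhdsOne_iff.2 fun y hy => le_pointwiseNhdsOne_iff.1 le_rfl y (h hy)

lemma tendsto_mul_pointwiseNhdsOne (Y : Set X) :
    Tendsto (fun p : (X ≃ₗᵢ[ℝ] X) × (X ≃ₗᵢ[ℝ] X) => p.1 * p.2)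
      (pointwiseNhdsOne Y ×ˢ pointwiseNhdsOne Y) (pointwiseNhdsOne Y) := by
  refine le_pointwiseNhdsOne_iff.2 fun y hy => tendsto_map'_iff.2 ?_
  have h := le_pointwiseNhdsOne_iff.1 (le_refl (pointwiseNhdsOne Y)) y hy
  have h' := tendsto_iff_dist_tendsto_zero.1 h
  refine tendsto_iff_dist_tendsto_zero.2 (squeeze_zero (fun _ => dist_nonneg) (fun p => ?_)
    (by simpa using (h'.comp tendsto_snd).add (h'.comp tendsto_fst)))
  have h1 := dist_triangle (p.1 (p.2 y)) (p.1 y) y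
  rwa [p.1.dist_map] at h1

lemma memEnv_iff {Y : Set X} {x : X} :
    MemEnv Y x ↔ Tendsto (fun T : X ≃ₗᵢ[ℝ] X => T x) (pointwiseNhdsOne Y) (𝓝 x) :=
  ⟨fun h => h _ inferInstance (le_pointwiseNhdsOne_iff.1 le_rfl),
    fun h _ _ hF => h.mono_left (le_pointwiseNhdsOne_iff.2 hF)⟩

/-- The set of points at which a filter of isometries converges to the identity is closed. -/
lemma isClosed_setOf_tendsto_apply (F : Filter (X ≃ₗᵢ[ℝ] X)) :
    IsClosed {x : X | Tendsto (fun T : X ≃ₗᵢ[ℝ] X => T x) F (𝓝 x)} := by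
  refine isClosed_of_closure_subset fun x hx => Metric.tendsto_nhds.2 fun ε hε => ?_
  obtain ⟨y, hy, hxy⟩ := Metric.mem_closure_iff.1 hx (ε / 3) (by positivity)
  filter_upwards [Metric.tendsto_nhds.1 hy (ε / 3) (by positivity)] with T hT
  have h1 := dist_triangle4 (T x) (T y) y x
  rw [T.dist_map, dist_comm y x] at h1
  linarith

lemma isClosed_setOf_memEnv (Y : Set X) : IsClosed {x : X | MemEnv Y x} := by
  simpa only [memEnv_iff] using isClosed_setOf_tendsto_apply (pointwiseNhdsOne Y)

lemma iInf_pointwiseNhdsOne_le_closure {ι : Type*} (Y : ι → Set X) :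
    ⨅ i, pointwiseNhdsOne (Y i) ≤ pointwiseNhdsOne (closure (⋃ i, Y i)) := by
  refine le_pointwiseNhdsOne_iff.2 fun y hy =>
    closure_minimal (iUnion_subset fun i y hy => ?_) (isClosed_setOf_tendsto_apply _) hy
  exact le_pointwiseNhdsOne_iff.1 (iInf_le _ i) y hy

end Envelope

/-- In a separable reflexive Banach space, if `Y` is the closed linear
span of a directed family `(Y_i)` of closed subspaces (i.e. the closure of their union),
then `Env(Y)` is the closure of the union of the envelopes `Env(Y_i)`. -/
theorem envelope_of_directed_union
    {X : Type*} [NormedAddCommGroup X] [NormedSpace ℝ X] [CompleteSpace X]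
    [TopologicalSpace.SeparableSpace X]
    (hrefl : Function.Surjective (NormedSpace.inclusionInDoubleDual ℝ X))
    {ι : Type*} [Nonempty ι] (Y : ι → Submodule ℝ X)
    (hclosed : ∀ i, IsClosed ((Y i) : Set X))
    (hdir : Directed (· ≤ ·) Y) :
    {x : X | MemEnv (closure (⋃ i, ((Y i) : Set X))) x}
      = closure (⋃ i, {x : X | MemEnv ((Y i) : Set X) x}) := by
  have hdir' : Directed (· ≥ ·) fun i => pointwiseNhdsOne (Y i : Set X) := fun i j => by
    obtain ⟨k, hi, hj⟩ := hdir i j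
    exact ⟨k, pointwiseNhdsOne_anti hi, pointwiseNhdsOne_anti hj⟩
  refine Subset.antisymm (fun x hx => Metric.mem_closure_iff.2 fun ε hε => ?_)
    (closure_minimal (iUnion_subset fun i x hx => ?_) (isClosed_setOf_memEnv _))
  · have hx' : Tendsto (fun T : X ≃ₗᵢ[ℝ] X => T x)
        (⨅ i, pointwiseNhdsOne (Y i : Set X)) (𝓝 x) :=
      (memEnv_iff.1 hx).mono_left (iInf_pointwiseNhdsOne_le_closure fun i => (Y i : Set X))
    obtain ⟨i, hi⟩ := (mem_iInf_of_directed hdir' _).1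
      (hx' (Metric.closedBall_mem_nhds x (half_pos hε)))
    obtain ⟨p, hp, hpt⟩ := exists_tendsto_apply_nhds_self hrefl _
      (tendsto_mul_pointwiseNhdsOne (Y i : Set X)) x
    refine ⟨p, mem_iUnion.2 ⟨i, memEnv_iff.2 hpt⟩, ?_⟩
    have hpx : p ∈ Metric.closedBall x (ε / 2) :=
      closedConvexHull_min (image_preimage_subset _ _) (convex_closedBall _ _)
        Metric.isClosed_closedBall (hp _ hi)
    rw [dist_comm]
    linarith [Metric.mem_closedBall.1 hpx]
  · exact memEnv_iff.2 ((memEnv_iff.1 hx).mono_left (pointwiseNhdsOne_anti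
      ((subset_iUnion (fun i => (Y i : Set X)) i).trans subset_closure)))
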